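/- Let T ∈ ITM(r) be a stable map that satisfies condition A2, and let J be a dynamically non-trivial interval component of X with continuity intervals J₁, …, J_N of the first return map R_J listed from left to right. Then R_J(J₁) ≠ J₁ and R_J(J_N) ≠ J_N; that is, the return map cannot fix the boundary subintervals. -/

import Mathlib

open Set Filter
open scoped Classical

/-- An interval translation map on `r ≥ 2` intervals: discontinuity points
`0 = β₀ < β₁ < ⋯ < β_{r−1} < β_r = 1` and translation parameters
`γ_i ∈ [−β_{i−1}, 1−β_i]`, acting by `T(x) = x + γ_i` for `x ∈ [β_{i−1}, β_i)`. -/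
structure ITM (r : ℕ) : Type where
  beta : Fin (r + 1) → ℝ
  gamma : Fin r → ℝ
  two_le_r : 2 ≤ r
  beta_zero : beta 0 = 0
  beta_last : beta (Fin.last r) = 1
  beta_mono : StrictMono beta
  gamma_mem : ∀ i : Fin r, gamma i ∈ Set.Icc (-(beta i.castSucc)) (1 - beta i.succ)

namespace ITM

variable {r : ℕ}

/-- The unit interval `I = [0,1)`. -/
def unitIco : Set ℝ := Set.Ico 0 1

/-- Index of the partition interval `I_i = [β_{i−1}, β_i)` containing `x`. -/
noncomputable def idx (T : ITM r) (x : ℝ) : Fin r :=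
  if h : ∃ i : Fin r, x ∈ Set.Ico (T.beta i.castSucc) (T.beta i.succ) then h.choose
  else ⟨0, by have := T.two_le_r; omega⟩

/-- The interval translation map itself (right-continuous version), extended by the
identity off `[0,1)`. -/
noncomputable def f (T : ITM r) (x : ℝ) : ℝ :=
  if x ∈ unitIco then x + T.gamma (T.idx x) else x

/-- Index of the partition interval `(β_{i−1}, β_i]` containing `x` (left-limit version). -/
noncomputable def idxm (T : ITM r) (x : ℝ) : Fin r :=
  if h : ∃ i : Fin r, x ∈ Set.Ioc (T.beta i.castSucc) (T.beta i.succ) then h.choose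
  else ⟨0, by have := T.two_le_r; omega⟩

/-- The left-limit version of `T`: `T(x⁻) = lim_{t↑x} T(t)`. -/
noncomputable def fm (T : ITM r) (x : ℝ) : ℝ :=
  if x ∈ Set.Ioc (0 : ℝ) 1 then x + T.gamma (T.idxm x) else x

/-- Dynamics on signed points: `(x, true)` represents `x⁺` and `(x, false)` represents `x⁻`. -/
noncomputable def sf (T : ITM r) (p : ℝ × Bool) : ℝ × Bool :=
  if p.2 then (T.f p.1, true) else (T.fm p.1, false)

/-- `X_n = T^n(I)`. -/
noncomputable def Xn (T : ITM r) (n : ℕ) : Set ℝ := (T.f)^[n] '' unitIco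

/-- The attractor `X = ⋂_{n≥0} X_n`. -/
noncomputable def X (T : ITM r) : Set ℝ := ⋂ n : ℕ, T.Xn n

/-- The closure `X̄` of the attractor in `[0,1]` (equivalently, in `ℝ`). -/
noncomputable def Xbar (T : ITM r) : Set ℝ := closure T.X

/-- `T` is of finite type if `X_{n+1} = X_n` for some `n`. -/
def FiniteType (T : ITM r) : Prop := ∃ n : ℕ, T.Xn (n + 1) = T.Xn n

/-- The set of (unsigned) discontinuities `{β₁, …, β_{r−1}}` of `T`. -/
def critSet (T : ITM r) : Set ℝ :=
  {b : ℝ | ∃ i : Fin (r + 1), i ≠ 0 ∧ i ≠ Fin.last r ∧ b = T.beta i}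

/-- The signed critical set `𝒞 = {β₁⁻, β₁⁺, …, β_{r−1}⁻, β_{r−1}⁺}`. -/
def signedCrit (T : ITM r) : Set (ℝ × Bool) := {p : ℝ × Bool | p.1 ∈ T.critSet}

/-- `x` lands on a discontinuity of `T`: some forward iterate (`k ≥ 0`) is a discontinuity. -/
def landsOnCrit (T : ITM r) (x : ℝ) : Prop := ∃ k : ℕ, (T.f)^[k] x ∈ T.critSet

/-- The first return time of `x` to the set `J` (by convention `0` if `x` never returns). -/
noncomputable def returnTime (T : ITM r) (J : Set ℝ) (x : ℝ) : ℕ :=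
  sInf {k : ℕ | 0 < k ∧ (T.f)^[k] x ∈ J}

/-- The first return map `R_J`. -/
noncomputable def returnMap (T : ITM r) (J : Set ℝ) (x : ℝ) : ℝ :=
  (T.f)^[T.returnTime J x] x

/-- `J` is an interval component of `X`: a connected component of `X` which is a
(nondegenerate, half-open) interval `[x,y)`. -/
def IsIntervalComponent (T : ITM r) (J : Set ℝ) : Prop :=
  (∃ z ∈ T.X, J = connectedComponentIn T.X z) ∧ ∃ x y : ℝ, x < y ∧ J = Set.Ico x y

/-- A dynamically trivial interval component: no point of its interior lands on a
discontinuity and the first return map is the identity. -/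
def DynTrivial (T : ITM r) (J : Set ℝ) : Prop :=
  T.IsIntervalComponent J ∧ (∀ a ∈ interior J, ¬ T.landsOnCrit a) ∧
    ∀ z ∈ J, T.returnMap J z = z

/-- Signed membership in `[x,y)`: `+`-points of `[x,y)` and `−`-points of `(x,y]`. -/
def smem (x y : ℝ) (p : ℝ × Bool) : Prop :=
  if p.2 then p.1 ∈ Set.Ico x y else p.1 ∈ Set.Ioc x y

/-- First return time of a signed point to the interval `[x,y)`. -/
noncomputable def sReturnTime (T : ITM r) (x y : ℝ) (p : ℝ × Bool) : ℕ :=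
  sInf {k : ℕ | 0 < k ∧ smem x y ((T.sf)^[k] p)}

/-- Condition A1: for every interval component `J` of `X` and every `a ∈ J`, the orbit of
`a` up to (and not including) its return time to `J` contains at most one critical point. -/
def A1 (T : ITM r) : Prop :=
  ∀ J : Set ℝ, T.IsIntervalComponent J → ∀ a ∈ J,
    Set.Subsingleton {c : ℝ | c ∈ T.critSet ∧ ∃ k < T.returnTime J a, (T.f)^[k] a = c}

/-- Condition A2: for every dynamically non-trivial interval component `[x,y)`, neither
(signed) boundary point `x⁺`, `y⁻` lands on a discontinuity up to (and not including)
its return time. -/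
def A2 (T : ITM r) : Prop :=
  ∀ x y : ℝ, T.IsIntervalComponent (Set.Ico x y) → ¬ T.DynTrivial (Set.Ico x y) →
    (∀ k < T.sReturnTime x y (x, true), (T.sf)^[k] (x, true) ∉ T.signedCrit) ∧
    (∀ k < T.sReturnTime x y (y, false), (T.sf)^[k] (y, false) ∉ T.signedCrit)

/-- `c'` is a ghost preimage of `c`: a signed discontinuity of opposite sign whose
(signed) orbit lands on the point of `c` with the sign of `c'`. -/
def GhostPre (T : ITM r) (c' c : ℝ × Bool) : Prop :=
  c ∈ T.signedCrit ∧ c' ∈ T.signedCrit ∧ c'.2 = !c.2 ∧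
    ∃ k : ℕ, (T.sf)^[k] c' = (c.1, c'.2)

/-- A descending chain of length `n` in a ghost tree: `c (i+1)` is a ghost preimage of `c i`. -/
def GhostChain (T : ITM r) (n : ℕ) (c : ℕ → ℝ × Bool) : Prop :=
  ∀ i < n, T.GhostPre (c (i + 1)) (c i)

/-- `b` occurs as a vertex of positive level in its own ghost tree `GT(b)`. -/
def SelfGhost (T : ITM r) (b : ℝ × Bool) : Prop :=
  ∃ n : ℕ, 0 < n ∧ ∃ c : ℕ → ℝ × Bool, c 0 = b ∧ c n = b ∧ T.GhostChain n c

/-- Condition A3: no discontinuity `β ∉ X` occurs in its own ghost tree at positive level. -/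
def A3 (T : ITM r) : Prop := ∀ b ∈ T.signedCrit, b.1 ∉ T.X → ¬ T.SelfGhost b

/-- The Absence of Critical Connections condition. -/
def ACC (T : ITM r) : Prop := T.A1 ∧ T.A2 ∧ T.A3

/-- The Matching condition: for every dynamically non-trivial interval component `J` of
`X`, exactly one point of the interior of `J` lands on a critical point before returning. -/
def Matching (T : ITM r) : Prop :=
  ∀ J : Set ℝ, T.IsIntervalComponent J → ¬ T.DynTrivial J →
    ∃! a : ℝ, a ∈ interior J ∧ ∃ k < T.returnTime J a, (T.f)^[k] a ∈ T.critSet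

/-- Distance between two maps in the parameter space `ITM(r)`. -/
noncomputable def pdist (T S : ITM r) : ℝ := dist T.gamma S.gamma ⊔ dist T.beta S.beta

/-- The number of discontinuities of `T` contained in `I ∖ X̄`. -/
noncomputable def ncritOutside (T : ITM r) : ℕ := (T.critSet \ T.Xbar).ncard

/-- `T` is stable: on some neighbourhood `𝒰` of `T` in `ITM(r)`, the assignment
`T̃ ↦ X̄(T̃)` is continuous in the Hausdorff topology, all `X̄(T̃)` are homeomorphic to
`X̄(T)`, and the number of discontinuities in `I ∖ X̄(T̃)` is constant. -/
def Stable (T : ITM r) : Prop :=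
  ∃ δ : ℝ, 0 < δ ∧
    (∀ S : ITM r, pdist S T < δ → Nonempty (S.Xbar ≃ₜ T.Xbar)) ∧
    (∀ S : ITM r, pdist S T < δ → ∀ ε : ℝ, 0 < ε → ∃ η : ℝ, 0 < η ∧
      ∀ S' : ITM r, pdist S' T < δ → pdist S' S < η →
        Metric.hausdorffDist S'.Xbar S.Xbar < ε) ∧
    (∀ S : ITM r, pdist S T < δ → S.ncritOutside = T.ncritOutside)

/-- The non-wandering set `Ω(T)` (neighbourhoods taken inside `I = [0,1)`). -/
def nonwandering (T : ITM r) : Set ℝ :=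
  {x : ℝ | x ∈ unitIco ∧ ∀ U : Set ℝ, IsOpen U → x ∈ U →
    ∃ n : ℕ, 0 < n ∧ ((T.f)^[n] '' (U ∩ unitIco) ∩ (U ∩ unitIco)).Nonempty}

/-- `S` and `S'` are topologically conjugate on the sets `A`, `B`: there is a
homeomorphism `h : A → B` with `h ∘ S = S' ∘ h` on `A`. -/
def TopConjOn (S S' : ITM r) (A B : Set ℝ) : Prop :=
  ∃ h g : ℝ → ℝ, Set.BijOn h A B ∧ ContinuousOn h A ∧ Set.InvOn g h A B ∧
    ContinuousOn g B ∧ ∀ x ∈ A, h (S.f x) = S'.f (h x)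

/-- No point of the interior of `K` lands on a discontinuity before its return time to `J`. -/
def NoCritBeforeReturnOn (T : ITM r) (J K : Set ℝ) : Prop :=
  ∀ z ∈ interior K, ∀ k < T.returnTime J z, (T.f)^[k] z ∉ T.critSet

/-- `K` is a continuity interval of the first return map `R_J`: a maximal half-open
subinterval of `J` no interior point of which lands on a discontinuity before returning. -/
def IsContinuityInterval (T : ITM r) (J K : Set ℝ) : Prop :=
  (∃ u v : ℝ, u < v ∧ K = Set.Ico u v) ∧ K ⊆ J ∧ T.NoCritBeforeReturnOn J K ∧
    ∀ K' : Set ℝ, (∃ u v : ℝ, u < v ∧ K' = Set.Ico u v) → K ⊆ K' → K' ⊆ J →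
      T.NoCritBeforeReturnOn J K' → K' = K

/-- The itinerary symbol of a signed point. -/
noncomputable def sidx (T : ITM r) (p : ℝ × Bool) : Fin r :=
  if p.2 then T.idx p.1 else T.idxm p.1

/-- The forward orbit of `x` accumulates on `c` from the left. -/
def accumFromLeft (T : ITM r) (x c : ℝ) : Prop :=
  ∃ n : ℕ → ℕ, StrictMono n ∧ StrictMono (fun k => (T.f)^[n k] x) ∧
    Filter.Tendsto (fun k => (T.f)^[n k] x) Filter.atTop (nhds c)

/-- The forward orbit of `x` accumulates on `c` from the right. -/
def accumFromRight (T : ITM r) (x c : ℝ) : Prop :=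
  ∃ n : ℕ → ℕ, StrictMono n ∧ StrictAnti (fun k => (T.f)^[n k] x) ∧
    Filter.Tendsto (fun k => (T.f)^[n k] x) Filter.atTop (nhds c)

end ITM

open MeasureTheory

namespace ITM

variable {r : ℕ} (T : ITM r)

/-- The partition interval `[β_{i−1}, β_i)`. -/
def cell (i : Fin r) : Set ℝ := Set.Ico (T.beta i.castSucc) (T.beta i.succ)

lemma beta_nonneg (i : Fin (r + 1)) : 0 ≤ T.beta i := by
  rw [← T.beta_zero]; exact T.beta_mono.monotone (Fin.zero_le i)

lemma beta_le_one (i : Fin (r + 1)) : T.beta i ≤ 1 := by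
  rw [← T.beta_last]; exact T.beta_mono.monotone (Fin.le_last i)

lemma cell_subset_unitIco (i : Fin r) : T.cell i ⊆ unitIco := fun _ hz =>
  ⟨(T.beta_nonneg _).trans hz.1, hz.2.trans_le (T.beta_le_one _)⟩

lemma exists_mem_cell {z : ℝ} (hz : z ∈ unitIco) : ∃ i, z ∈ T.cell i := by
  have key : ∀ n : ℕ, ∀ hn : n < r + 1, z < T.beta ⟨n, hn⟩ → ∃ i, z ∈ T.cell i := by
    intro n
    induction n with
    | zero =>
      intro hn h
      have : T.beta ⟨0, hn⟩ = 0 := T.beta_zero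
      linarith [hz.1]
    | succ n ih =>
      intro hn h
      by_cases h' : z < T.beta ⟨n, by omega⟩
      · exact ih _ h'
      · exact ⟨⟨n, by omega⟩, not_lt.1 h', h⟩
  refine key r (by omega) ?_
  have : T.beta ⟨r, by omega⟩ = 1 := T.beta_last
  linarith [hz.2]

lemma exists_mem_Ioc_beta {z : ℝ} (hz : z ∈ Set.Ioc (0 : ℝ) 1) :
    ∃ i : Fin r, z ∈ Set.Ioc (T.beta i.castSucc) (T.beta i.succ) := by
  have key : ∀ n : ℕ, ∀ hn : n < r + 1, z ≤ T.beta ⟨n, hn⟩ →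
      ∃ i : Fin r, z ∈ Set.Ioc (T.beta i.castSucc) (T.beta i.succ) := by
    intro n
    induction n with
    | zero =>
      intro hn h
      have : T.beta ⟨0, hn⟩ = 0 := T.beta_zero
      linarith [hz.1]
    | succ n ih =>
      intro hn h
      by_cases h' : z ≤ T.beta ⟨n, by omega⟩
      · exact ih _ h'
      · exact ⟨⟨n, by omega⟩, not_le.1 h', h⟩
  refine key r (by omega) ?_
  have : T.beta ⟨r, by omega⟩ = 1 := T.beta_last
  linarith [hz.2]

lemma succ_le_castSucc_beta {i j : Fin r} (h : i < j) :
    T.beta i.succ ≤ T.beta j.castSucc :=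
  T.beta_mono.monotone (Fin.succ_le_castSucc_iff.2 h)

lemma cell_index_unique {z : ℝ} {i j : Fin r} (hi : z ∈ T.cell i) (hj : z ∈ T.cell j) :
    i = j := by
  rcases lt_trichotomy i j with h | h | h
  · linarith [T.succ_le_castSucc_beta h, hi.2, hj.1]
  · exact h
  · linarith [T.succ_le_castSucc_beta h, hj.2, hi.1]

lemma f_of_mem_cell {z : ℝ} {i : Fin r} (hi : z ∈ T.cell i) : T.f z = z + T.gamma i := by
  have hex : ∃ i : Fin r, z ∈ Set.Ico (T.beta i.castSucc) (T.beta i.succ) := ⟨i, hi⟩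
  have hidx : T.idx z = i := by
    rw [idx, dif_pos hex]
    exact T.cell_index_unique hex.choose_spec hi
  rw [f, if_pos (T.cell_subset_unitIco i hi), hidx]

lemma fm_of_mem_Ioc {z : ℝ} {i : Fin r}
    (hi : z ∈ Set.Ioc (T.beta i.castSucc) (T.beta i.succ)) : T.fm z = z + T.gamma i := by
  have hex : ∃ i : Fin r, z ∈ Set.Ioc (T.beta i.castSucc) (T.beta i.succ) := ⟨i, hi⟩
  have hidx : T.idxm z = i := by
    rw [idxm, dif_pos hex]
    have hj := hex.choose_spec
    rcases lt_trichotomy hex.choose i with h | h | h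
    · linarith [T.succ_le_castSucc_beta h, hj.2, hi.1]
    · exact h
    · linarith [T.succ_le_castSucc_beta h, hi.2, hj.1]
  have hz : z ∈ Set.Ioc (0 : ℝ) 1 :=
    ⟨(T.beta_nonneg _).trans_lt hi.1, hi.2.trans (T.beta_le_one _)⟩
  rw [fm, if_pos hz, hidx]

lemma f_mem_unitIco {z : ℝ} (hz : z ∈ unitIco) : T.f z ∈ unitIco := by
  obtain ⟨i, hi⟩ := T.exists_mem_cell hz
  rw [T.f_of_mem_cell hi]
  have := T.gamma_mem i
  exact ⟨by linarith [this.1, hi.1], by linarith [this.2, hi.2]⟩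

lemma iterate_mem_unitIco {z : ℝ} (hz : z ∈ unitIco) (n : ℕ) : (T.f)^[n] z ∈ unitIco := by
  induction n with
  | zero => exact hz
  | succ n ih => rw [Function.iterate_succ_apply']; exact T.f_mem_unitIco ih

lemma Xn_succ (n : ℕ) : T.Xn (n + 1) = T.f '' T.Xn n := by
  rw [Xn, Xn, Function.iterate_succ', Set.image_comp]

lemma Xn_antitone : Antitone T.Xn := by
  refine antitone_nat_of_succ_le fun n => ?_
  rintro _ ⟨z, hz, rfl⟩
  exact ⟨T.f z, T.f_mem_unitIco hz, (Function.iterate_succ_apply _ _ _).symm⟩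

lemma X_subset_unitIco : T.X ⊆ unitIco := by
  intro z hz
  have := Set.mem_iInter.1 hz 0
  simpa [Xn] using this

lemma f_mem_X {z : ℝ} (hz : z ∈ T.X) : T.f z ∈ T.X := by
  refine Set.mem_iInter.2 fun n => T.Xn_antitone n.le_succ ?_
  rw [Nat.succ_eq_add_one, T.Xn_succ]
  exact Set.mem_image_of_mem _ (Set.mem_iInter.1 hz n)

lemma iterate_mem_X {z : ℝ} (hz : z ∈ T.X) (n : ℕ) : (T.f)^[n] z ∈ T.X := by
  induction n with
  | zero => exact hz
  | succ n ih => rw [Function.iterate_succ_apply']; exact T.f_mem_X ih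

/-- `T` maps `X` onto itself. -/
lemma exists_preimage_mem_X {z : ℝ} (hz : z ∈ T.X) : ∃ w ∈ T.X, T.f w = z := by
  have h : ∀ n, ∃ i : Fin r, z - T.gamma i ∈ T.Xn n ∧ T.f (z - T.gamma i) = z := by
    intro n
    have hz' := Set.mem_iInter.1 hz (n + 1)
    rw [T.Xn_succ] at hz'
    obtain ⟨w, hw, hwz⟩ := hz'
    have hwI : w ∈ unitIco := by
      simpa [Xn] using T.Xn_antitone (Nat.zero_le n) hw
    obtain ⟨i, hi⟩ := T.exists_mem_cell hwI
    have hwi : z - T.gamma i = w := by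
      rw [← hwz, T.f_of_mem_cell hi]; ring
    exact ⟨i, by rwa [hwi], by rwa [hwi]⟩
  choose g hg using h
  obtain ⟨i, hi⟩ := Finite.exists_infinite_fiber g
  have hi' : (g ⁻¹' {i}).Infinite := Set.infinite_coe_iff.1 hi
  have hpre : ∀ n, ∃ m, n < m ∧ g m = i := fun n => by
    obtain ⟨m, hm, hnm⟩ := hi'.exists_gt n
    exact ⟨m, hnm, hm⟩
  refine ⟨z - T.gamma i, Set.mem_iInter.2 fun n => ?_, ?_⟩
  · obtain ⟨m, hnm, rfl⟩ := hpre n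
    exact T.Xn_antitone hnm.le (hg m).1
  · obtain ⟨m, -, rfl⟩ := hpre 0
    exact (hg m).2

lemma mem_X_of_periodic {z : ℝ} (hz : z ∈ unitIco) {m : ℕ} (hm : 0 < m)
    (h : (T.f)^[m] z = z) : z ∈ T.X := by
  refine Set.mem_iInter.2 fun n => T.Xn_antitone (Nat.le_mul_of_pos_left n hm) ?_
  refine ⟨z, hz, ?_⟩
  rw [Function.iterate_mul]
  exact Function.iterate_fixed h n

lemma measurable_f : Measurable T.f := by
  intro A hA
  have h : T.f ⁻¹' A = (A \ unitIco) ∪ ⋃ i, T.cell i ∩ (fun z => z + T.gamma i) ⁻¹' A := by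
    ext z
    by_cases hz : z ∈ unitIco
    · obtain ⟨i, hi⟩ := T.exists_mem_cell hz
      simp only [Set.mem_preimage, Set.mem_union, Set.mem_sdiff, hz, not_true_eq_false, and_false,
        false_or, Set.mem_iUnion, Set.mem_inter_iff]
      constructor
      · intro hA'
        exact ⟨i, hi, by rwa [← T.f_of_mem_cell hi]⟩
      · rintro ⟨j, hj, hA'⟩
        rwa [T.f_of_mem_cell hj]
    · have hf : T.f z = z := by rw [f, if_neg hz]
      have : ∀ i, z ∉ T.cell i := fun i hi => hz (T.cell_subset_unitIco i hi)
      simp [hf, hz, this]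
  rw [h]
  exact (hA.diff measurableSet_Ico).union (MeasurableSet.iUnion fun i =>
    measurableSet_Ico.inter ((measurable_id.add_const _) hA))

lemma image_f_eq_iUnion {B : Set ℝ} (hB : B ⊆ unitIco) :
    T.f '' B = ⋃ i, (fun z => z + T.gamma i) '' (B ∩ T.cell i) := by
  ext w
  simp only [Set.mem_iUnion]
  constructor
  · rintro ⟨z, hz, rfl⟩
    obtain ⟨i, hi⟩ := T.exists_mem_cell (hB hz)
    exact ⟨i, z, ⟨hz, hi⟩, (T.f_of_mem_cell hi).symm⟩
  · rintro ⟨i, z, ⟨hz, hi⟩, rfl⟩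
    exact ⟨z, hz, T.f_of_mem_cell hi⟩

lemma measurableSet_image_f {B : Set ℝ} (hB : B ⊆ unitIco) (hm : MeasurableSet B) :
    MeasurableSet (T.f '' B) := by
  rw [T.image_f_eq_iUnion hB]
  exact MeasurableSet.iUnion fun i =>
    (measurableEmbedding_addRight (T.gamma i)).measurableSet_image.2 (hm.inter measurableSet_Ico)

lemma volume_image_f_le {B : Set ℝ} (hB : B ⊆ unitIco) (hm : MeasurableSet B) :
    volume (T.f '' B) ≤ volume B := by
  have hdisj : Pairwise (Function.onFun Disjoint fun i => B ∩ T.cell i) := by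
    intro i j hij
    refine Set.disjoint_left.2 fun z hi hj => hij (T.cell_index_unique hi.2 hj.2)
  have hBU : B = ⋃ i, B ∩ T.cell i := by
    ext z
    simp only [Set.mem_iUnion, Set.mem_inter_iff]
    exact ⟨fun hz => (T.exists_mem_cell (hB hz)).imp fun i hi => ⟨hz, hi⟩, fun ⟨_, h⟩ => h.1⟩
  calc volume (T.f '' B)
      ≤ ∑' i, volume ((fun z => z + T.gamma i) '' (B ∩ T.cell i)) := by
        rw [T.image_f_eq_iUnion hB]; exact measure_iUnion_le _
    _ = ∑' i, volume (B ∩ T.cell i) := by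
        simp only [Set.image_add_right, measure_preimage_add_right]
    _ = volume B := by
        conv_rhs => rw [hBU]
        rw [measure_iUnion hdisj fun i => hm.inter measurableSet_Ico]

lemma measurableSet_X : MeasurableSet T.X := by
  refine MeasurableSet.iInter fun n => ?_
  induction n with
  | zero => simp [Xn, unitIco]
  | succ n ih =>
    rw [T.Xn_succ]
    refine T.measurableSet_image_f ?_ ih
    intro z hz
    simpa [Xn] using T.Xn_antitone (Nat.zero_le n) hz

lemma volume_X_lt_top : volume T.X < ⊤ :=
  (measure_mono T.X_subset_unitIco).trans_lt (by simp [unitIco])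

/-- `T` preserves Lebesgue measure on its attractor. -/
lemma measurePreserving_f :
    MeasurePreserving T.f (volume.restrict T.X) (volume.restrict T.X) := by
  have : IsFiniteMeasure (volume.restrict T.X) := ⟨by simpa using T.volume_X_lt_top⟩
  refine ⟨T.measurable_f, (Measure.eq_of_le_of_measure_univ_eq ?_ ?_).symm⟩
  · refine Measure.le_iff.2 fun A hA => ?_
    rw [Measure.map_apply T.measurable_f hA, Measure.restrict_apply hA,
      Measure.restrict_apply (T.measurable_f hA)]
    have hsub : A ∩ T.X ⊆ T.f '' (T.f ⁻¹' A ∩ T.X) := by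
      rintro z ⟨hzA, hzX⟩
      obtain ⟨w, hw, rfl⟩ := T.exists_preimage_mem_X hzX
      exact ⟨w, ⟨hzA, hw⟩, rfl⟩
    exact (measure_mono hsub).trans (T.volume_image_f_le
      (Set.inter_subset_right.trans T.X_subset_unitIco)
      ((T.measurable_f hA).inter T.measurableSet_X))
  · rw [Measure.map_apply T.measurable_f MeasurableSet.univ, Set.preimage_univ]

/-- Poincaré recurrence for open subintervals of the attractor. -/
lemma exists_recurrent {u v : ℝ} (huv : u < v) (h : Set.Ico u v ⊆ T.X) :
    ∃ w ∈ Set.Ioo u v, ∃ k, 0 < k ∧ (T.f)^[k] w ∈ Set.Ioo u v := by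
  have : IsFiniteMeasure (volume.restrict T.X) := ⟨by simpa using T.volume_X_lt_top⟩
  have hpos : (volume.restrict T.X) (Set.Ioo u v) ≠ 0 := by
    rw [Measure.restrict_apply measurableSet_Ioo,
      Set.inter_eq_left.2 (Set.Ioo_subset_Ico_self.trans h)]
    simpa using huv
  obtain ⟨w, hw, k, hk, hkw⟩ :=
    T.measurePreserving_f.conservative.exists_mem_iterate_mem
      measurableSet_Ioo.nullMeasurableSet hpos
  exact ⟨w, hw, k, Nat.pos_of_ne_zero hk, hkw⟩

/-- The first partition interval. -/
def firstIdx : Fin r := ⟨0, by have := T.two_le_r; omega⟩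

/-- The last partition interval. -/
def lastIdx : Fin r := ⟨r - 1, by have := T.two_le_r; omega⟩

lemma firstIdx_castSucc : T.firstIdx.castSucc = 0 := rfl

lemma lastIdx_succ : T.lastIdx.succ = Fin.last r := by
  have := T.two_le_r
  ext
  simp only [lastIdx, Fin.succ_mk, Fin.val_last]
  omega

lemma beta_firstIdx_succ_pos : 0 < T.beta T.firstIdx.succ := by
  rw [← T.beta_zero]
  exact T.beta_mono (Fin.succ_pos _)

lemma beta_firstIdx_succ_lt_one : T.beta T.firstIdx.succ < 1 := by
  rw [← T.beta_last]
  refine T.beta_mono (Fin.lt_def.2 ?_)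
  have := T.two_le_r
  simp only [firstIdx, Fin.succ_mk, Fin.val_last]
  omega

lemma beta_lastIdx_castSucc_pos : 0 < T.beta T.lastIdx.castSucc := by
  rw [← T.beta_zero]
  refine T.beta_mono (Fin.lt_def.2 ?_)
  have := T.two_le_r
  simp only [lastIdx, Fin.castSucc_mk, Fin.val_zero]
  omega

lemma beta_lastIdx_castSucc_lt_one : T.beta T.lastIdx.castSucc < 1 := by
  rw [← T.beta_last, ← T.lastIdx_succ]
  exact T.beta_mono Fin.castSucc_lt_succ

lemma beta_firstIdx_succ_le {j : Fin r} (hj : j ≠ T.firstIdx) :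
    T.beta T.firstIdx.succ ≤ T.beta j.castSucc :=
  T.succ_le_castSucc_beta (Fin.lt_def.2 (Nat.pos_of_ne_zero fun h => hj (Fin.ext h)))

lemma le_beta_lastIdx_castSucc {j : Fin r} (hj : j ≠ T.lastIdx) :
    T.beta j.succ ≤ T.beta T.lastIdx.castSucc := by
  refine T.succ_le_castSucc_beta (Fin.lt_def.2 ?_)
  have h1 : j.val ≠ r - 1 := fun h => hj (Fin.ext h)
  have h2 := j.isLt
  simp only [lastIdx]
  omega

/-- The map with the same discontinuities as `T` and translation parameters `g`. -/
def withGamma (g : Fin r → ℝ)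
    (hg : ∀ i : Fin r, g i ∈ Set.Icc (-(T.beta i.castSucc)) (1 - T.beta i.succ)) : ITM r :=
  { T with gamma := g, gamma_mem := hg }

lemma pdist_lt_of_beta_eq {S S' : ITM r} {e : ℝ} (he : 0 < e) (hb : S.beta = S'.beta)
    (hg : ∀ i, |S.gamma i - S'.gamma i| < e) : pdist S S' < e := by
  rw [pdist, hb, dist_self, sup_lt_iff]
  exact ⟨(dist_pi_lt_iff he).2 fun i => by rw [Real.dist_eq]; exact hg i, he⟩

/-- A point of the attractor of a map in the stability neighbourhood cannot be avoided
uniformly by the attractors of arbitrarily small perturbations. -/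
lemma Stable.false_of_avoid {δ : ℝ}
    (hhom : ∀ S : ITM r, pdist S T < δ → Nonempty (S.Xbar ≃ₜ T.Xbar))
    (hcont : ∀ S : ITM r, pdist S T < δ → ∀ ε : ℝ, 0 < ε → ∃ η : ℝ, 0 < η ∧
      ∀ S' : ITM r, pdist S' T < δ → pdist S' S < η →
        Metric.hausdorffDist S'.Xbar S.Xbar < ε)
    {S : ITM r} (hS : pdist S T < δ) {p c : ℝ} (hp : p ∈ S.Xbar) (hc : 0 < c)
    (hav : ∀ η : ℝ, 0 < η → ∃ S' : ITM r, pdist S' T < δ ∧ pdist S' S < η ∧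
      ∀ z ∈ S'.X, c ≤ |p - z|) : False := by
  obtain ⟨η, hη, h⟩ := hcont S hS c hc
  obtain ⟨S', hS'T, hS'S, hz⟩ := hav η hη
  have hbdd : ∀ R : ITM r, Bornology.IsBounded R.Xbar := fun R =>
    ((Metric.isBounded_Ico 0 1).subset R.X_subset_unitIco).closure
  have hne : S'.Xbar.Nonempty := by
    obtain ⟨e⟩ := hhom S hS
    obtain ⟨e'⟩ := hhom S' hS'T
    exact ⟨_, (e'.symm (e ⟨p, hp⟩)).2⟩
  have hfin := Metric.hausdorffEDist_ne_top_of_nonempty_of_bounded hne ⟨p, hp⟩ (hbdd S') (hbdd S)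
  obtain ⟨z, hzX, hzd⟩ := Metric.exists_dist_lt_of_hausdorffDist_lt' hp (h S' hS'T hS'S) hfin
  have hclosed : IsClosed {z : ℝ | c ≤ |p - z|} :=
    isClosed_le continuous_const (by fun_prop)
  have : c ≤ |p - z| := closure_minimal hz hclosed hzX
  rw [← Real.dist_eq, dist_comm] at this
  linarith [dist_comm z p]

lemma Stable.gamma_firstIdx_ne_zero (hstab : T.Stable) : T.gamma T.firstIdx ≠ 0 := by
  intro h0
  obtain ⟨δ, hδ, hhom, hcont, -⟩ := hstab
  obtain ⟨s, hs0, hs⟩ : ∃ s : ℝ, 0 < s ∧ s < min δ 1 := exists_between (lt_min hδ one_pos)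
  obtain ⟨hsδ, hs1⟩ := lt_min_iff.1 hs
  have hb0 := T.beta_firstIdx_succ_pos
  have hb1 := T.beta_firstIdx_succ_lt_one
  let g : ℝ → Fin r → ℝ := fun e j => if j = T.firstIdx then e else
    (1 - s) * T.gamma j + s * (1 - T.beta j.succ)
  have hg : ∀ e, 0 ≤ e → e ≤ 1 - T.beta T.firstIdx.succ →
      ∀ j : Fin r, g e j ∈ Set.Icc (-(T.beta j.castSucc)) (1 - T.beta j.succ) := by
    intro e he he' j
    by_cases hj : j = T.firstIdx
    · simp only [g, hj, if_true, firstIdx_castSucc, T.beta_zero]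
      exact ⟨by linarith, he'⟩
    · simp only [g, hj, if_false]
      have := T.gamma_mem j
      exact ⟨by nlinarith [this.1, this.2], by nlinarith [this.1, this.2]⟩
  have hclose : ∀ e, 0 ≤ e → e < δ → ∀ j, |g e j - T.gamma j| < δ := by
    intro e he heδ j
    by_cases hj : j = T.firstIdx
    · simp only [g, hj, if_true, h0, sub_zero]
      rwa [abs_of_nonneg he]
    · simp only [g, hj, if_false]
      have := T.gamma_mem j
      have hlt : T.beta j.castSucc < T.beta j.succ := T.beta_mono Fin.castSucc_lt_succ
      rw [abs_lt]
      exact ⟨by nlinarith [this.1, this.2], by nlinarith [this.1, this.2]⟩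
  have hle : (0 : ℝ) ≤ 1 - T.beta T.firstIdx.succ := by linarith
  let S := T.withGamma (g 0) (hg 0 le_rfl hle)
  have hS : pdist S T < δ := pdist_lt_of_beta_eq hδ rfl (hclose 0 le_rfl hδ)
  have hp : (0 : ℝ) ∈ S.Xbar := by
    refine subset_closure (S.mem_X_of_periodic ⟨le_rfl, one_pos⟩ one_pos ?_)
    have hmem : (0 : ℝ) ∈ S.cell T.firstIdx :=
      ⟨by change T.beta 0 ≤ 0; rw [T.beta_zero], hb0⟩
    rw [Function.iterate_one, S.f_of_mem_cell hmem]
    simp [S, withGamma, g]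
  refine Stable.false_of_avoid T hhom hcont hS hp (mul_pos hs0 hb0) fun η hη => ?_
  obtain ⟨e, he0, he⟩ : ∃ e : ℝ, 0 < e ∧ e < min (min δ η) (1 - T.beta T.firstIdx.succ) :=
    exists_between (lt_min (lt_min hδ hη) (by linarith))
  obtain ⟨he', heb⟩ := lt_min_iff.1 he
  obtain ⟨heδ, heη⟩ := lt_min_iff.1 he'
  let S' := T.withGamma (g e) (hg e he0.le heb.le)
  refine ⟨S', pdist_lt_of_beta_eq hδ rfl (hclose e he0.le heδ),
    pdist_lt_of_beta_eq hη rfl fun j => ?_, fun z hz => ?_⟩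
  · change |g e j - g 0 j| < η
    by_cases hj : j = T.firstIdx
    · simp only [g, hj, if_true, sub_zero]
      rwa [abs_of_nonneg he0.le]
    · simpa [g, hj] using hη
  · by_contra hlt
    have hz0 := (S'.X_subset_unitIco hz).1
    rw [zero_sub, abs_neg, abs_of_nonneg hz0, not_le] at hlt
    have hdesc : ∀ n : ℕ, z - n * e ∈ S'.X := by
      intro n
      induction n with
      | zero => simpa using hz
      | succ n ih =>
        obtain ⟨w, hw, hwz⟩ := S'.exists_preimage_mem_X ih
        obtain ⟨j, hj⟩ := S'.exists_mem_cell (S'.X_subset_unitIco hw)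
        rw [S'.f_of_mem_cell hj] at hwz
        change w + g e j = _ at hwz
        by_cases hjf : j = T.firstIdx
        · simp only [g, hjf, if_true] at hwz
          have : z - ((n + 1 : ℕ) : ℝ) * e = w := by push_cast; linarith
          rwa [this]
        · simp only [g, hjf, if_false] at hwz
          have hwj : T.beta j.castSucc ≤ w := hj.1
          have h1 := T.beta_firstIdx_succ_le hjf
          have h2 := (T.gamma_mem j).1
          have h3 := T.beta_le_one j.succ
          have hn : (0 : ℝ) ≤ n * e := by positivity
          nlinarith
    obtain ⟨n, hn⟩ := exists_nat_gt (z / e)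
    rw [div_lt_iff₀ he0] at hn
    linarith [(S'.X_subset_unitIco (hdesc n)).1]

lemma Stable.gamma_lastIdx_ne_zero (hstab : T.Stable) : T.gamma T.lastIdx ≠ 0 := by
  intro h0
  obtain ⟨δ, hδ, hhom, hcont, -⟩ := hstab
  obtain ⟨s, hs0, hs⟩ : ∃ s : ℝ, 0 < s ∧ s < min δ 1 := exists_between (lt_min hδ one_pos)
  obtain ⟨hsδ, hs1⟩ := lt_min_iff.1 hs
  have hb0 := T.beta_lastIdx_castSucc_pos
  have hb1 := T.beta_lastIdx_castSucc_lt_one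
  have hlast : T.beta T.lastIdx.succ = 1 := by rw [T.lastIdx_succ, T.beta_last]
  let g : ℝ → Fin r → ℝ := fun e j => if j = T.lastIdx then -e else
    (1 - s) * T.gamma j + s * (-T.beta j.castSucc)
  have hg : ∀ e, 0 ≤ e → e ≤ T.beta T.lastIdx.castSucc →
      ∀ j : Fin r, g e j ∈ Set.Icc (-(T.beta j.castSucc)) (1 - T.beta j.succ) := by
    intro e he he' j
    by_cases hj : j = T.lastIdx
    · simp only [g, hj, if_true, hlast]
      exact ⟨by linarith, by linarith⟩
    · simp only [g, hj, if_false]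
      have := T.gamma_mem j
      exact ⟨by nlinarith [this.1, this.2], by nlinarith [this.1, this.2]⟩
  have hclose : ∀ e, 0 ≤ e → e < δ → ∀ j, |g e j - T.gamma j| < δ := by
    intro e he heδ j
    by_cases hj : j = T.lastIdx
    · simp only [g, hj, if_true, h0, sub_zero, abs_neg]
      rwa [abs_of_nonneg he]
    · simp only [g, hj, if_false]
      have := T.gamma_mem j
      have hlt : T.beta j.castSucc < T.beta j.succ := T.beta_mono Fin.castSucc_lt_succ
      rw [abs_lt]
      exact ⟨by nlinarith [this.1, this.2], by nlinarith [this.1, this.2]⟩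
  let S := T.withGamma (g 0) (hg 0 le_rfl hb0.le)
  have hS : pdist S T < δ := pdist_lt_of_beta_eq hδ rfl (hclose 0 le_rfl hδ)
  have hp : (1 : ℝ) ∈ S.Xbar := by
    have hsub : Set.Ico (T.beta T.lastIdx.castSucc) 1 ⊆ S.X := by
      intro z hz
      have hmem : z ∈ S.cell T.lastIdx := ⟨hz.1, by
        change z < T.beta T.lastIdx.succ; rw [hlast]; exact hz.2⟩
      refine S.mem_X_of_periodic ⟨hb0.le.trans hz.1, hz.2⟩ one_pos ?_
      rw [Function.iterate_one, S.f_of_mem_cell hmem]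
      simp [S, withGamma, g]
    refine closure_mono hsub ?_
    rw [closure_Ico hb1.ne]
    exact ⟨hb1.le, le_rfl⟩
  refine Stable.false_of_avoid T hhom hcont hS hp (mul_pos hs0 (sub_pos.2 hb1)) fun η hη => ?_
  obtain ⟨e, he0, he⟩ : ∃ e : ℝ, 0 < e ∧ e < min (min δ η) (T.beta T.lastIdx.castSucc) :=
    exists_between (lt_min (lt_min hδ hη) hb0)
  obtain ⟨he', heb⟩ := lt_min_iff.1 he
  obtain ⟨heδ, heη⟩ := lt_min_iff.1 he'
  let S' := T.withGamma (g e) (hg e he0.le heb.le)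
  refine ⟨S', pdist_lt_of_beta_eq hδ rfl (hclose e he0.le heδ),
    pdist_lt_of_beta_eq hη rfl fun j => ?_, fun z hz => ?_⟩
  · change |g e j - g 0 j| < η
    by_cases hj : j = T.lastIdx
    · simp only [g, hj, if_true, neg_zero, sub_zero, abs_neg]
      rwa [abs_of_nonneg he0.le]
    · simpa [g, hj] using hη
  · by_contra hlt
    have hz1 := (S'.X_subset_unitIco hz).2
    rw [abs_of_nonneg (by linarith), not_le] at hlt
    have hasc : ∀ n : ℕ, z + n * e ∈ S'.X := by
      intro n
      induction n with
      | zero => simpa using hz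
      | succ n ih =>
        obtain ⟨w, hw, hwz⟩ := S'.exists_preimage_mem_X ih
        obtain ⟨j, hj⟩ := S'.exists_mem_cell (S'.X_subset_unitIco hw)
        rw [S'.f_of_mem_cell hj] at hwz
        change w + g e j = _ at hwz
        by_cases hjf : j = T.lastIdx
        · simp only [g, hjf, if_true] at hwz
          have : z + ((n + 1 : ℕ) : ℝ) * e = w := by push_cast; linarith
          rwa [this]
        · simp only [g, hjf, if_false] at hwz
          have hwj : w < T.beta j.succ := hj.2
          have h1 := T.le_beta_lastIdx_castSucc hjf
          have h2 := (T.gamma_mem j).2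
          have h3 := T.beta_nonneg j.castSucc
          have hn : (0 : ℝ) ≤ n * e := by positivity
          nlinarith
    obtain ⟨n, hn⟩ := exists_nat_gt ((1 - z) / e)
    rw [div_lt_iff₀ he0] at hn
    linarith [(S'.X_subset_unitIco (hasc n)).2]

lemma beta_castSucc_mem_critSet {i : Fin r} (h : 0 < T.beta i.castSucc) :
    T.beta i.castSucc ∈ T.critSet := by
  refine ⟨i.castSucc, ?_, (Fin.castSucc_lt_last i).ne, rfl⟩
  intro h0
  rw [h0, T.beta_zero] at h
  exact lt_irrefl _ h

lemma beta_succ_mem_critSet {i : Fin r} (h : T.beta i.succ < 1) :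
    T.beta i.succ ∈ T.critSet := by
  refine ⟨i.succ, Fin.succ_ne_zero i, ?_, rfl⟩
  intro h1
  rw [h1, T.beta_last] at h
  exact lt_irrefl _ h

lemma IsIntervalComponent.subset_X {J : Set ℝ} (hJ : T.IsIntervalComponent J) : J ⊆ T.X := by
  obtain ⟨⟨z, -, rfl⟩, -⟩ := hJ
  exact connectedComponentIn_subset _ _

lemma IsIntervalComponent.subset_of_isPreconnected {J S : Set ℝ}
    (hJ : T.IsIntervalComponent J) (hS : IsPreconnected S) (hSX : S ⊆ T.X) {w : ℝ}
    (hwS : w ∈ S) (hwJ : w ∈ J) : S ⊆ J := by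
  obtain ⟨⟨z, -, rfl⟩, -⟩ := hJ
  rw [connectedComponentIn_eq hwJ]
  exact hS.subset_connectedComponentIn hwS hSX

lemma returnTime_spec {J : Set ℝ} {w : ℝ} (h : ∃ k, 0 < k ∧ (T.f)^[k] w ∈ J) :
    0 < T.returnTime J w ∧ (T.f)^[T.returnTime J w] w ∈ J :=
  Nat.sInf_mem (s := {k : ℕ | 0 < k ∧ (T.f)^[k] w ∈ J}) h

lemma notMem_of_lt_returnTime {J : Set ℝ} {w : ℝ} {k : ℕ} (hk : 0 < k)
    (h : k < T.returnTime J w) : (T.f)^[k] w ∉ J := fun hw =>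
  Nat.notMem_of_lt_sInf h ⟨hk, hw⟩

lemma returnTime_eq {J : Set ℝ} {w : ℝ} {m : ℕ} (hm : 0 < m) (hmJ : (T.f)^[m] w ∈ J)
    (hlt : ∀ k, 0 < k → k < m → (T.f)^[k] w ∉ J) : T.returnTime J w = m := by
  obtain ⟨h0, h⟩ := T.returnTime_spec ⟨m, hm, hmJ⟩
  refine le_antisymm (Nat.sInf_le ⟨hm, hmJ⟩) (not_lt.1 fun hlt' => hlt _ h0 hlt' h)

/-- The largest left neighbourhood of `w` in `[u, w]` on which the first `k` iterates act as
translations starts either at `u` or at a point that lands on a discontinuity before time `k`. -/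
lemma exists_translation_neighbourhood {u w : ℝ} (huw : u ≤ w) (h : Set.Icc u w ⊆ unitIco)
    (k : ℕ) : ∃ p ∈ Set.Icc u w,
      (∀ j ≤ k, ∀ z ∈ Set.Icc p w, (T.f)^[j] z = z + ((T.f)^[j] w - w)) ∧
      (p = u ∨ ∃ j < k, (T.f)^[j] p ∈ T.critSet) := by
  induction k with
  | zero =>
    refine ⟨u, ⟨le_rfl, huw⟩, fun j hj z _ => ?_, Or.inl rfl⟩
    obtain rfl := Nat.le_zero.1 hj
    simp
  | succ k ih =>
    obtain ⟨p, hp, htr, hcrit⟩ := ih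
    have hw : w ∈ unitIco := h ⟨huw, le_rfl⟩
    obtain ⟨i, hi⟩ := T.exists_mem_cell (T.iterate_mem_unitIco hw k)
    have hstep : ∀ q, p ≤ q → T.beta i.castSucc ≤ q + ((T.f)^[k] w - w) →
        ∀ j ≤ k + 1, ∀ z ∈ Set.Icc q w, (T.f)^[j] z = z + ((T.f)^[j] w - w) := by
      intro q hpq hq j hj z hz
      rcases Nat.le_succ_iff.1 hj with hj | rfl
      · exact htr j hj z ⟨hpq.trans hz.1, hz.2⟩
      · have hzk := htr k le_rfl z ⟨hpq.trans hz.1, hz.2⟩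
        have hzi : (T.f)^[k] z ∈ T.cell i := by
          rw [hzk]
          exact ⟨by linarith [hz.1], by linarith [hz.2, hi.2]⟩
        rw [Function.iterate_succ_apply', Function.iterate_succ_apply',
          T.f_of_mem_cell hzi, T.f_of_mem_cell hi, hzk]
        ring
    by_cases hpi : T.beta i.castSucc ≤ p + ((T.f)^[k] w - w)
    · exact ⟨p, hp, hstep p le_rfl hpi,
        hcrit.imp id fun ⟨j, hj, hjc⟩ => ⟨j, hj.trans k.lt_succ_self, hjc⟩⟩
    · rw [not_le] at hpi
      have hpw : p ≤ T.beta i.castSucc - ((T.f)^[k] w - w) := by linarith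
      have hqw : T.beta i.castSucc - ((T.f)^[k] w - w) ≤ w := by linarith [hi.1]
      refine ⟨T.beta i.castSucc - ((T.f)^[k] w - w), ⟨hp.1.trans hpw, hqw⟩,
        hstep _ hpw (by linarith), Or.inr ⟨k, k.lt_succ_self, ?_⟩⟩
      rw [htr k le_rfl _ ⟨hpw, hqw⟩, sub_add_cancel]
      apply T.beta_castSucc_mem_critSet
      have h0 := (T.iterate_mem_unitIco (h hp) k).1
      rw [htr k le_rfl p ⟨le_rfl, hp.2⟩] at h0
      linarith

/-- If `w` in the interior of a continuity interval `[u, v)` returns to `J`, then all of `[u, w]`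
returns simultaneously, by translations. -/
lemma returnTime_eq_of_le {J : Set ℝ} (hJ : T.IsIntervalComponent J) {u v w : ℝ}
    (hK : Set.Ico u v ⊆ J) (hcrit : T.NoCritBeforeReturnOn J (Set.Ico u v))
    (hw : w ∈ Set.Ioo u v) (hret : ∃ k, 0 < k ∧ (T.f)^[k] w ∈ J) :
    ∀ z ∈ Set.Icc u w, T.returnTime J z = T.returnTime J w ∧
      ∀ j ≤ T.returnTime J w, (T.f)^[j] z = z + ((T.f)^[j] w - w) := by
  obtain ⟨hm0, hmJ⟩ := T.returnTime_spec hret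
  have hKX : Set.Icc u w ⊆ T.X := fun z hz =>
    hJ.subset_X T (hK ⟨hz.1, hz.2.trans_lt hw.2⟩)
  obtain ⟨p, hp, htr, hpc⟩ := T.exists_translation_neighbourhood hw.1.le
    (hKX.trans T.X_subset_unitIco) (T.returnTime J w)
  have hret' : ∀ z ∈ Set.Icc p w, T.returnTime J z = T.returnTime J w := by
    intro z hz
    have himg : ∀ j ≤ T.returnTime J w, ((T.f)^[j] z ∈ J ↔ (T.f)^[j] w ∈ J) := by
      intro j hj
      have hSX : (fun s => s + ((T.f)^[j] w - w)) '' Set.Icc p w ⊆ T.X := by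
        rintro _ ⟨s, hs, rfl⟩
        simp only
        rw [← htr j hj s hs]
        exact T.iterate_mem_X (hKX ⟨hp.1.trans hs.1, hs.2⟩) j
      have hS : IsPreconnected ((fun s => s + ((T.f)^[j] w - w)) '' Set.Icc p w) :=
        isPreconnected_Icc.image _ (by fun_prop)
      have hzS : (T.f)^[j] z ∈ (fun s => s + ((T.f)^[j] w - w)) '' Set.Icc p w :=
        ⟨z, hz, (htr j hj z hz).symm⟩
      have hwS : (T.f)^[j] w ∈ (fun s => s + ((T.f)^[j] w - w)) '' Set.Icc p w :=
        ⟨w, ⟨hp.2, le_rfl⟩, by ring⟩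
      exact ⟨fun h => hJ.subset_of_isPreconnected T hS hSX hzS h hwS,
        fun h => hJ.subset_of_isPreconnected T hS hSX hwS h hzS⟩
    refine T.returnTime_eq hm0 ((himg _ le_rfl).2 hmJ) fun k hk hkm h => ?_
    exact T.notMem_of_lt_returnTime hk hkm ((himg k hkm.le).1 h)
  rcases hpc with rfl | ⟨j, hj, hjc⟩
  · exact fun z hz => ⟨hret' z hz, fun j hj => htr j hj z hz⟩
  · rcases hp.1.eq_or_lt with rfl | hup
    · exact fun z hz => ⟨hret' z hz, fun j hj => htr j hj z hz⟩
    · refine absurd hjc (hcrit p ?_ j ?_)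
      · rw [interior_Ico]
        exact ⟨hup, hp.2.trans_lt hw.2⟩
      · rwa [hret' p ⟨le_rfl, hp.2⟩]

/-- On a continuity interval the return time is positive and constant, and the iterates up to
the return time act as translations. -/
lemma exists_returnTime_translation {J : Set ℝ} (hJ : T.IsIntervalComponent J) {u v : ℝ}
    (huv : u < v) (hK : Set.Ico u v ⊆ J) (hcrit : T.NoCritBeforeReturnOn J (Set.Ico u v)) :
    ∃ m, 0 < m ∧ ∀ z ∈ Set.Ico u v, T.returnTime J z = m ∧ (T.f)^[m] z ∈ J ∧
      ∀ j ≤ m, (T.f)^[j] z = z + ((T.f)^[j] u - u) := by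
  have hrec : ∀ z ∈ Set.Ico u v, ∃ w ∈ Set.Ioo u v, z ≤ w ∧ ∃ k, 0 < k ∧ (T.f)^[k] w ∈ J := by
    intro z hz
    have hsub : Set.Ico z v ⊆ J := (Set.Ico_subset_Ico_left hz.1).trans hK
    obtain ⟨w, hw, k, hk, hkw⟩ := T.exists_recurrent hz.2 (hsub.trans (hJ.subset_X T))
    exact ⟨w, ⟨hz.1.trans_lt hw.1, hw.2⟩, hw.1.le, k, hk, hsub (Set.Ioo_subset_Ico_self hkw)⟩
  have hall : ∀ z ∈ Set.Ico u v, T.returnTime J z = T.returnTime J u ∧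
      (∃ k, 0 < k ∧ (T.f)^[k] z ∈ J) ∧
      ∀ j ≤ T.returnTime J u, (T.f)^[j] z = z + ((T.f)^[j] u - u) := by
    intro z hz
    obtain ⟨w, hw, hzw, hret⟩ := hrec z hz
    have key := T.returnTime_eq_of_le hJ hK hcrit hw hret
    obtain ⟨hz1, hz2⟩ := key z ⟨hz.1, hzw⟩
    obtain ⟨hu1, hu2⟩ := key u ⟨le_rfl, hw.1.le⟩
    obtain ⟨hm0, hmJ⟩ := T.returnTime_spec hret
    refine ⟨hz1.trans hu1.symm, ⟨T.returnTime J z, hz1 ▸ hm0, ?_⟩, fun j hj => ?_⟩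
    · have hS : Set.Icc z w ⊆ Set.Icc u w := Set.Icc_subset_Icc_left hz.1
      have hSX : (fun s => s + ((T.f)^[T.returnTime J w] w - w)) '' Set.Icc z w ⊆ T.X := by
        rintro _ ⟨s, hs, rfl⟩
        simp only
        rw [← (key s (hS hs)).2 _ le_rfl]
        exact T.iterate_mem_X (hJ.subset_X T (hK ⟨(hS hs).1, hs.2.trans_lt hw.2⟩)) _
      refine hJ.subset_of_isPreconnected T (isPreconnected_Icc.image _ (by fun_prop)) hSX
        ⟨w, ⟨hzw, le_rfl⟩, by ring⟩ hmJ ⟨z, ⟨le_rfl, hzw⟩, ?_⟩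
      rw [hz1]
      exact (hz2 _ le_rfl).symm
    · rw [hz2 j (hu1 ▸ hj), hu2 j (hu1 ▸ hj)]
      ring
  refine ⟨T.returnTime J u, (T.returnTime_spec (hall u ⟨le_rfl, huv⟩).2.1).1, fun z hz => ?_⟩
  obtain ⟨h1, h2, h3⟩ := hall z hz
  exact ⟨h1, h1 ▸ (T.returnTime_spec h2).2, h3⟩

/-- If the return map fixes a continuity interval, it does so pointwise. -/
lemma exists_iterate_eq_of_image_eq {J : Set ℝ} (hJ : T.IsIntervalComponent J) {u v : ℝ}
    (huv : u < v) (hK : Set.Ico u v ⊆ J) (hcrit : T.NoCritBeforeReturnOn J (Set.Ico u v))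
    (himg : T.returnMap J '' Set.Ico u v = Set.Ico u v) :
    ∃ m, 0 < m ∧ (T.f)^[m] u = u ∧ ∀ z ∈ Set.Ico u v, T.returnTime J z = m ∧
      ∀ j ≤ m, (T.f)^[j] z = z + ((T.f)^[j] u - u) := by
  obtain ⟨m, hm, h⟩ := T.exists_returnTime_translation hJ huv hK hcrit
  have hu : u ∈ Set.Ico u v := ⟨le_rfl, huv⟩
  refine ⟨m, hm, le_antisymm ?_ ?_, fun z hz => ⟨(h z hz).1, (h z hz).2.2⟩⟩
  · obtain ⟨w, hw, hwu⟩ := himg.symm ▸ hu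
    rw [returnMap, (h w hw).1, (h w hw).2.2 m le_rfl] at hwu
    linarith [hw.1]
  · have := himg ▸ Set.mem_image_of_mem (T.returnMap J) hu
    rw [returnMap, (h u hu).1] at this
    exact this.1

lemma sf_iterate_true (z : ℝ) (k : ℕ) : (T.sf)^[k] (z, true) = ((T.f)^[k] z, true) := by
  induction k with
  | zero => rfl
  | succ k ih => rw [Function.iterate_succ_apply', ih, Function.iterate_succ_apply']; rfl

lemma sf_iterate_false (z : ℝ) (k : ℕ) : (T.sf)^[k] (z, false) = ((T.fm)^[k] z, false) := by
  induction k with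
  | zero => rfl
  | succ k ih => rw [Function.iterate_succ_apply', ih, Function.iterate_succ_apply']; rfl

lemma sReturnTime_true (x y z : ℝ) :
    T.sReturnTime x y (z, true) = T.returnTime (Set.Ico x y) z := by
  simp [sReturnTime, returnTime, sf_iterate_true, smem]

lemma lt_of_mem_cell_of_notMem_critSet {z : ℝ} {i : Fin r} (hi : z ∈ T.cell i) (hz : z ≠ 0)
    (hc : z ∉ T.critSet) : T.beta i.castSucc < z := by
  refine hi.1.lt_of_ne fun h => hc ?_
  rw [← h]
  refine T.beta_castSucc_mem_critSet ?_
  rw [h]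
  exact ((T.beta_nonneg _).trans hi.1).lt_of_ne hz.symm

/-- A point that returns to itself along an orbit avoiding `0` and the discontinuities has
a left neighbourhood of periodic points. -/
lemma exists_left_neighbourhood_subset_X {x : ℝ} (hx : x ∈ unitIco) {m : ℕ} (hm : 0 < m)
    (hper : (T.f)^[m] x = x) (hne : ∀ k < m, (T.f)^[k] x ≠ 0)
    (hcrit : ∀ k < m, (T.f)^[k] x ∉ T.critSet) :
    ∃ t, 0 < t ∧ ∀ s, 0 ≤ s → s ≤ t → x - s ∈ T.X := by
  have key : ∀ k ≤ m, ∃ t, 0 < t ∧ ∀ s, 0 ≤ s → s ≤ t →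
      (T.f)^[k] (x - s) = (T.f)^[k] x - s := by
    intro k
    induction k with
    | zero => exact fun _ => ⟨1, one_pos, fun s _ _ => rfl⟩
    | succ k ih =>
      intro hk
      obtain ⟨t, ht, h⟩ := ih (by omega)
      obtain ⟨i, hi⟩ := T.exists_mem_cell (T.iterate_mem_unitIco hx k)
      have hlt := T.lt_of_mem_cell_of_notMem_critSet hi (hne k hk) (hcrit k hk)
      refine ⟨min t ((T.f)^[k] x - T.beta i.castSucc), lt_min ht (sub_pos.2 hlt),
        fun s hs0 hs => ?_⟩
      obtain ⟨hst, hsb⟩ := le_min_iff.1 hs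
      have hmem : (T.f)^[k] x - s ∈ T.cell i := ⟨by linarith, by linarith [hi.2]⟩
      rw [Function.iterate_succ_apply', Function.iterate_succ_apply', h s hs0 hst,
        T.f_of_mem_cell hmem, T.f_of_mem_cell hi]
      ring
  obtain ⟨t, ht, h⟩ := key m le_rfl
  have hx0 : 0 < x := hx.1.lt_of_ne (hne 0 hm).symm
  refine ⟨min t x, lt_min ht hx0, fun s hs0 hs => ?_⟩
  obtain ⟨hst, hsx⟩ := le_min_iff.1 hs
  refine T.mem_X_of_periodic ⟨by linarith, by linarith [hx.2]⟩ hm ?_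
  rw [h s hs0 hst, hper]

/-- A periodic orbit through `0` that avoids the discontinuities is the fixed point `0`. -/
lemma gamma_firstIdx_eq_zero {x : ℝ} (hx : x ∈ unitIco) {m : ℕ}
    (hper : (T.f)^[m] x = x) (hcrit : ∀ k < m, (T.f)^[k] x ∉ T.critSet)
    {k : ℕ} (hk : k < m) (h0 : (T.f)^[k] x = 0) : T.gamma T.firstIdx = 0 := by
  obtain ⟨l, hl, hl0⟩ : ∃ l < m, T.f ((T.f)^[l] x) = 0 := by
    rcases k with _ | k
    · refine ⟨m - 1, by omega, ?_⟩
      rw [← Function.iterate_succ_apply' T.f, show (m - 1).succ = m by omega, hper]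
      exact h0
    · exact ⟨k, by omega, by rwa [← Function.iterate_succ_apply' T.f]⟩
  obtain ⟨i, hi⟩ := T.exists_mem_cell (T.iterate_mem_unitIco hx l)
  have hg := (T.gamma_mem i).1
  rw [T.f_of_mem_cell hi] at hl0
  have hz : (T.f)^[l] x = 0 := by
    by_contra hne
    linarith [T.lt_of_mem_cell_of_notMem_critSet hi hne (hcrit l hl)]
  have hfirst : T.firstIdx = i := by
    refine T.cell_index_unique ?_ hi
    rw [hz]
    exact ⟨by rw [firstIdx_castSucc, T.beta_zero], T.beta_firstIdx_succ_pos⟩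
  rw [hfirst]
  linarith

/-- Left limits of iterates that act as translations on `[u, y)`. -/
lemma fm_iterate_eq {u y : ℝ} (huy : u < y) (hI : Set.Ico u y ⊆ unitIco) {m : ℕ}
    {c : ℕ → ℝ} (h : ∀ z ∈ Set.Ico u y, ∀ j ≤ m, (T.f)^[j] z = z + c j) :
    ∀ j ≤ m, (T.fm)^[j] y = y + c j ∧ y + c j ∈ Set.Ioc (0 : ℝ) 1 := by
  have hmem : ∀ j ≤ m, y + c j ∈ Set.Ioc (0 : ℝ) 1 := by
    intro j hj
    have hin : ∀ z ∈ Set.Ico u y, z + c j ∈ unitIco := fun z hz => by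
      rw [← h z hz j hj]
      exact T.iterate_mem_unitIco (hI hz) j
    refine ⟨by linarith [(hin u ⟨le_rfl, huy⟩).1], le_of_forall_lt_imp_le_of_dense fun q hq => ?_⟩
    by_cases hqu : u ≤ q - c j
    · have := (hin (q - c j) ⟨hqu, by linarith⟩).2
      linarith
    · linarith [(hin u ⟨le_rfl, huy⟩).2]
  intro j
  induction j with
  | zero =>
    intro _
    have := h u ⟨le_rfl, huy⟩ 0 (Nat.zero_le _)
    exact ⟨by simp only [Function.iterate_zero, id_eq] at this ⊢; linarith, hmem 0 (Nat.zero_le _)⟩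
  | succ j ih =>
    intro hj
    refine ⟨?_, hmem _ hj⟩
    obtain ⟨i, hi⟩ := T.exists_mem_Ioc_beta (hmem j (by omega))
    rw [Function.iterate_succ_apply', (ih (by omega)).1, T.fm_of_mem_Ioc hi]
    obtain ⟨z, hz, hzy⟩ : ∃ z, max u (T.beta i.castSucc - c j) < z ∧ z < y :=
      exists_between (max_lt huy (by linarith [hi.1]))
    obtain ⟨hzu, hzb⟩ := max_lt_iff.1 hz
    have hzI : z ∈ Set.Ico u y := ⟨hzu.le, hzy⟩
    have hzi : z + c j ∈ T.cell i := ⟨by linarith, by linarith [hi.2]⟩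
    have h1 := h z hzI (j + 1) hj
    rw [Function.iterate_succ_apply', h z hzI j (by omega), T.f_of_mem_cell hzi] at h1
    linarith

lemma lt_of_mem_Ioc_beta_of_notMem_critSet {z : ℝ} {i : Fin r}
    (hi : z ∈ Set.Ioc (T.beta i.castSucc) (T.beta i.succ)) (hz : z ≠ 1)
    (hc : z ∉ T.critSet) : z < T.beta i.succ := by
  refine hi.2.lt_of_ne fun h => hc ?_
  rw [h]
  refine T.beta_succ_mem_critSet ?_
  rw [← h]
  exact (hi.2.trans (T.beta_le_one _)).lt_of_ne hz

lemma f_eq_fm {z : ℝ} (hz : z ∈ Set.Ioc (0 : ℝ) 1) (hz1 : z ≠ 1) (hc : z ∉ T.critSet) :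
    T.f z = T.fm z := by
  obtain ⟨i, hi⟩ := T.exists_mem_Ioc_beta hz
  rw [T.fm_of_mem_Ioc hi,
    T.f_of_mem_cell ⟨hi.1.le, T.lt_of_mem_Ioc_beta_of_notMem_critSet hi hz1 hc⟩]

/-- A periodic orbit of left limits through `1` that avoids the discontinuities is the
fixed point `1`. -/
lemma gamma_lastIdx_eq_zero {y : ℝ} {m : ℕ} (hmem : ∀ k < m, (T.fm)^[k] y ∈ Set.Ioc (0 : ℝ) 1)
    (hper : (T.fm)^[m] y = y) (hcrit : ∀ k < m, (T.fm)^[k] y ∉ T.critSet)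
    {k : ℕ} (hk : k < m) (h1 : (T.fm)^[k] y = 1) : T.gamma T.lastIdx = 0 := by
  obtain ⟨l, hl, hl1⟩ : ∃ l < m, T.fm ((T.fm)^[l] y) = 1 := by
    rcases k with _ | k
    · refine ⟨m - 1, by omega, ?_⟩
      rw [← Function.iterate_succ_apply' T.fm, show (m - 1).succ = m by omega, hper]
      exact h1
    · exact ⟨k, by omega, by rwa [← Function.iterate_succ_apply' T.fm]⟩
  obtain ⟨i, hi⟩ := T.exists_mem_Ioc_beta (hmem l hl)
  have hg := (T.gamma_mem i).2
  rw [T.fm_of_mem_Ioc hi] at hl1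
  have hz : (T.fm)^[l] y = 1 := by
    by_contra hne
    linarith [T.lt_of_mem_Ioc_beta_of_notMem_critSet hi hne (hcrit l hl)]
  have hlast : i = T.lastIdx := by
    by_contra hne
    linarith [T.le_beta_lastIdx_castSucc hne, T.beta_lastIdx_castSucc_lt_one, hi.2]
  rw [← hlast]
  linarith

lemma returnMap_image_first_ne (hstab : T.Stable) (h2 : T.A2) {x y a : ℝ}
    (hJ : T.IsIntervalComponent (Set.Ico x y)) (hnt : ¬ T.DynTrivial (Set.Ico x y)) (hxa : x < a)
    (hK : Set.Ico x a ⊆ Set.Ico x y)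
    (hcrit : T.NoCritBeforeReturnOn (Set.Ico x y) (Set.Ico x a)) :
    T.returnMap (Set.Ico x y) '' Set.Ico x a ≠ Set.Ico x a := by
  intro himg
  obtain ⟨m, hm, hper, hret⟩ := T.exists_iterate_eq_of_image_eq hJ hxa hK hcrit himg
  have hxa' : x ∈ Set.Ico x a := ⟨le_rfl, hxa⟩
  have hxX : x ∈ T.X := hJ.subset_X T (hK hxa')
  have hxI : x ∈ unitIco := T.X_subset_unitIco hxX
  have hc : ∀ k < m, (T.f)^[k] x ∉ T.critSet := by
    intro k hk
    have := (h2 x y hJ hnt).1 k (by rwa [sReturnTime_true, (hret x hxa').1])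
    rwa [sf_iterate_true] at this
  by_cases hne : ∀ k < m, (T.f)^[k] x ≠ 0
  · obtain ⟨t, ht, h⟩ := T.exists_left_neighbourhood_subset_X hxI hm hper hne hc
    have hsub : Set.Icc (x - t) x ⊆ T.X := fun z hz => by
      have := h (x - z) (by linarith [hz.2]) (by linarith [hz.1])
      rwa [sub_sub_cancel] at this
    have := hJ.subset_of_isPreconnected T isPreconnected_Icc hsub
      (w := x) ⟨by linarith, le_rfl⟩ (hK hxa') (⟨le_rfl, by linarith⟩ : x - t ∈ Set.Icc (x - t) x)
    linarith [this.1]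
  · push Not at hne
    obtain ⟨k, hk, h0⟩ := hne
    exact Stable.gamma_firstIdx_ne_zero T hstab (T.gamma_firstIdx_eq_zero hxI hper hc hk h0)

lemma returnMap_image_last_ne (hstab : T.Stable) (h2 : T.A2) {x y b : ℝ}
    (hJ : T.IsIntervalComponent (Set.Ico x y)) (hnt : ¬ T.DynTrivial (Set.Ico x y)) (hby : b < y)
    (hK : Set.Ico b y ⊆ Set.Ico x y)
    (hcrit : T.NoCritBeforeReturnOn (Set.Ico x y) (Set.Ico b y)) :
    T.returnMap (Set.Ico x y) '' Set.Ico b y ≠ Set.Ico b y := by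
  intro himg
  obtain ⟨m, hm, hper, hret⟩ := T.exists_iterate_eq_of_image_eq hJ hby hK hcrit himg
  have hbJ : b ∈ Set.Ico x y := hK ⟨le_rfl, hby⟩
  have hJX : Set.Ico x y ⊆ T.X := hJ.subset_X T
  have hfm := T.fm_iterate_eq hby (hK.trans (hJX.trans T.X_subset_unitIco))
    (c := fun j => (T.f)^[j] b - b) fun z hz => (hret z hz).2
  have hperm : (T.fm)^[m] y = y := by
    rw [(hfm m le_rfl).1, hper]; ring
  have hnot : ∀ k, 0 < k → k < m → (T.fm)^[k] y ∉ Set.Ioc x y := by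
    intro k hk0 hk hky
    rw [(hfm k hk.le).1] at hky
    set c := (T.f)^[k] b - b with hc
    obtain ⟨z, hz, hzy⟩ : ∃ z, max b (x - c) < z ∧ z < y :=
      exists_between (max_lt hby (by linarith [hky.1]))
    obtain ⟨hzb, hzx⟩ := max_lt_iff.1 hz
    obtain ⟨hz1, hz2⟩ := hret z ⟨hzb.le, hzy⟩
    refine T.notMem_of_lt_returnTime hk0 (hz1.symm ▸ hk) ?_
    rw [hz2 k hk.le]
    exact ⟨by linarith, by linarith [hky.2]⟩
  have hsret : m ≤ T.sReturnTime x y (y, false) := by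
    refine le_csInf ⟨m, hm, ?_⟩ ?_
    · rw [sf_iterate_false, hperm]
      simpa [smem] using hbJ.1.trans_lt hby
    · rintro k ⟨hk0, hk⟩
      rw [sf_iterate_false] at hk
      exact not_lt.1 fun hkm => hnot k hk0 hkm (by simpa [smem] using hk)
  have hc : ∀ k < m, (T.fm)^[k] y ∉ T.critSet := by
    intro k hk
    have := (h2 x y hJ hnt).2 k (hk.trans_le hsret)
    rwa [sf_iterate_false] at this
  have hmem : ∀ k < m, (T.fm)^[k] y ∈ Set.Ioc (0 : ℝ) 1 := fun k hk => by
    rw [(hfm k hk.le).1]; exact (hfm k hk.le).2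
  by_cases hne : ∀ k < m, (T.fm)^[k] y ≠ 1
  · have hiter : ∀ k ≤ m, (T.f)^[k] y = (T.fm)^[k] y := by
      intro k
      induction k with
      | zero => exact fun _ => rfl
      | succ k ih =>
        intro hk
        rw [Function.iterate_succ_apply', Function.iterate_succ_apply', ih (by omega),
          T.f_eq_fm (hmem k hk) (hne k hk) (hc k hk)]
    have hy := hmem 0 hm
    have hyX : y ∈ T.X := T.mem_X_of_periodic ⟨hy.1.le, hy.2.lt_of_ne (hne 0 hm)⟩ hm
      ((hiter m le_rfl).trans hperm)
    have hsub : Set.Icc x y ⊆ T.X := fun z hz => by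
      rcases hz.2.eq_or_lt with rfl | hlt
      · exact hyX
      · exact hJX ⟨hz.1, hlt⟩
    have := hJ.subset_of_isPreconnected T isPreconnected_Icc hsub
      (w := b) ⟨hbJ.1, hbJ.2.le⟩ hbJ (⟨hbJ.1.trans hbJ.2.le, le_rfl⟩ : y ∈ Set.Icc x y)
    exact lt_irrefl _ this.2
  · push Not at hne
    obtain ⟨k, hk, h1⟩ := hne
    exact Stable.gamma_lastIdx_ne_zero T hstab (T.gamma_lastIdx_eq_zero hmem hperm hc hk h1)

end ITM


/-- For a stable map `T` satisfying A2, the first return map to a dynamically non-trivial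
interval component `J = [x,y)` cannot fix the leftmost continuity interval `J₁ = [x,a)`
nor the rightmost continuity interval `J_N = [b,y)`. -/
theorem returnMap_not_fix_boundary_intervals {r : ℕ} (T : ITM r)
    (hstab : T.Stable) (h2 : T.A2) (x y a b : ℝ)
    (hJ : T.IsIntervalComponent (Set.Ico x y)) (hnt : ¬ T.DynTrivial (Set.Ico x y))
    (h1 : T.IsContinuityInterval (Set.Ico x y) (Set.Ico x a))
    (hN : T.IsContinuityInterval (Set.Ico x y) (Set.Ico b y)) :
    T.returnMap (Set.Ico x y) '' Set.Ico x a ≠ Set.Ico x a ∧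
    T.returnMap (Set.Ico x y) '' Set.Ico b y ≠ Set.Ico b y := by
  obtain ⟨⟨u, v, huv, hu⟩, hK, hc, -⟩ := h1
  obtain ⟨⟨u', v', huv', hu'⟩, hK', hc', -⟩ := hN
  have hxa : x < a := Set.nonempty_Ico.1 (hu ▸ Set.nonempty_Ico.2 huv)
  have hby : b < y := Set.nonempty_Ico.1 (hu' ▸ Set.nonempty_Ico.2 huv')
  exact ⟨T.returnMap_image_first_ne hstab h2 hJ hnt hxa hK hc,
    T.returnMap_image_last_ne hstab h2 hJ hnt hby hK' hc'⟩
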